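/- Let ρ be a real-valued radial neutral Schwartz function on ℝ², let I > 0, let v ∈ ℝ² with |v| < 1 and ω ∈ ℝ. Then ∫_{ℝ²}(Jy)·A_{v,ω}(y)ρ(y)dy = −ω ∫_{ℝ²} |∇ρ̂(k)|²/(|k|² − (v·k)²) dk, and hence the soliton angular momentum equals M_{v,ω} = Iω − ∫_{ℝ²}(Jy)·A_{v,ω}(y)ρ(y)dy = ω( I + ∫_{ℝ²} |∇ρ̂(k)|²/(|k|² − (v·k)²) dk ). -/

import Mathlib

open MeasureTheory
open scoped RealInnerProductSpace BigOperators

noncomputable section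

abbrev V2 : Type := EuclideanSpace ℝ (Fin 2)

/-- standard basis vector of ℝ² -/
def e2 (j : Fin 2) : V2 := EuclideanSpace.single j 1

/-- Fourier transform with normalization `(2π)⁻¹ ∫ e^{-ik·x} ρ(x) dx`. -/
def FT (ρ : V2 → ℝ) (k : V2) : ℂ :=
  ((2 * Real.pi : ℝ) : ℂ)⁻¹ * ∫ x : V2, Complex.exp (-Complex.I * ((⟪k, x⟫ : ℝ) : ℂ)) * (ρ x : ℂ)

/-- j-th partial derivative of a complex-valued function on ℝ². -/
def pd (f : V2 → ℂ) (j : Fin 2) (k : V2) : ℂ := fderiv ℝ f k (e2 j)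

/-- `|∇f(k)|²` for a complex-valued function on ℝ². -/
def gradNormSqC (f : V2 → ℂ) (k : V2) : ℝ := ∑ j, ‖pd f j k‖ ^ 2

/-- `D(k) = |k|² - (v·k)²`. -/
def Dv (v : V2) (k : V2) : ℝ := ‖k‖ ^ 2 - (⟪v, k⟫ : ℝ) ^ 2

/-- `(J ∇f)_j` where `J` has rows `(0,1)`, `(-1,0)`. -/
def Jgrad (f : V2 → ℂ) (j : Fin 2) (k : V2) : ℂ := ![pd f 1 k, -pd f 0 k] j

/-- Fourier transform of the soliton field `A_{v,ω}`. -/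
def Ahat (ρ : V2 → ℝ) (v : V2) (ω : ℝ) (j : Fin 2) (k : V2) : ℂ :=
  (((v j - k j * (⟪v, k⟫ : ℝ) / ‖k‖ ^ 2 : ℝ) : ℂ) * FT ρ k
      - Complex.I * (ω : ℂ) * Jgrad (FT ρ) j k) / ((Dv v k : ℝ) : ℂ)

/-- The soliton field `A_{v,ω}` (inverse Fourier transform of `Ahat`). -/
def Asol (ρ : V2 → ℝ) (v : V2) (ω : ℝ) (j : Fin 2) (y : V2) : ℝ :=
  (((2 * Real.pi : ℝ) : ℂ)⁻¹ *
    ∫ k : V2, Complex.exp (Complex.I * ((⟪k, y⟫ : ℝ) : ℂ)) * Ahat ρ v ω j k).re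

/-- The soliton field `Π_{v,ω} = -(v·∇) A_{v,ω}`. -/
def Pisol (ρ : V2 → ℝ) (v : V2) (ω : ℝ) (j : Fin 2) (y : V2) : ℝ :=
  - fderiv ℝ (Asol ρ v ω j) y v

/-- `|∇A(y)|² = ∑_{i,j} (∂_i A_j(y))²`. -/
def gradSq (A : Fin 2 → V2 → ℝ) (y : V2) : ℝ :=
  ∑ i, ∑ j, (fderiv ℝ (A j) y (e2 i)) ^ 2

/-- Field energy `½∫ (|Π|² + |∇A|²)`. -/
def fieldEnergy (A Pf : Fin 2 → V2 → ℝ) : ℝ :=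
  (1 / 2) * ∫ y : V2, ((∑ j, (Pf j y) ^ 2) + gradSq A y)

/-- `⟨Π, ∇_* A⟩_j = ∫ Π(y)·∂_j A(y) dy`. -/
def momTerm (A Pf : Fin 2 → V2 → ℝ) (j : Fin 2) : ℝ :=
  ∫ y : V2, ∑ l, Pf l y * fderiv ℝ (A l) y (e2 j)

/-- `⟨A, ρ⟩_j = ∫ A_j(y) ρ(y) dy`. -/
def chargeTerm (ρ : V2 → ℝ) (A : Fin 2 → V2 → ℝ) (j : Fin 2) : ℝ :=
  ∫ y : V2, A j y * ρ y

/-- `∫ (Jy)·A(y) ρ(y) dy` where `(Jy) = (y₂, -y₁)`. -/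
def angTerm (ρ : V2 → ℝ) (A : Fin 2 → V2 → ℝ) : ℝ :=
  ∫ y : V2, (y 1 * A 0 y - y 0 * A 1 y) * ρ y

/-- The reduced Hamiltonian `H_{P,M}(A,Π)`. -/
def Hred (m I : ℝ) (ρ : V2 → ℝ) (P : Fin 2 → ℝ) (M : ℝ) (A Pf : Fin 2 → V2 → ℝ) : ℝ :=
  fieldEnergy A Pf
    + (1 / (2 * m)) * ∑ j, (P j + momTerm A Pf j - chargeTerm ρ A j) ^ 2
    + (1 / (2 * I)) * (M + angTerm ρ A) ^ 2

/-- The soliton linear momentum `P_{v,ω}`. -/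
def Psol (ρ : V2 → ℝ) (m : ℝ) (v : V2) (ω : ℝ) (j : Fin 2) : ℝ :=
  m * v j - momTerm (Asol ρ v ω) (Pisol ρ v ω) j + chargeTerm ρ (Asol ρ v ω) j

/-- The soliton angular momentum `M_{v,ω}`. -/
def Msol (ρ : V2 → ℝ) (I : ℝ) (v : V2) (ω : ℝ) : ℝ :=
  I * ω - angTerm ρ (Asol ρ v ω)

open scoped FourierTransform LineDeriv SchwartzMap ComplexConjugate

/-- A real-valued Schwartz function seen as a complex-valued one. -/
def complexify (f : 𝓢(V2, ℝ)) : 𝓢(V2, ℂ) := f.postcompCLM Complex.ofRealCLM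

/-- Multiplication of a Schwartz function by the `j`-th coordinate. -/
def coordMul (j : Fin 2) (f : 𝓢(V2, ℝ)) : 𝓢(V2, ℝ) :=
  SchwartzMap.smulLeftCLM ℝ (fun x : V2 ↦ x j) f

/-- The dilation `k ↦ (2π)⁻¹ k`. -/
def dilation : V2 ≃L[ℝ] V2 :=
  ContinuousLinearEquiv.smulLeft (Units.mk0 ((2 * Real.pi)⁻¹ : ℝ) (by positivity))

lemma complexify_apply (f : 𝓢(V2, ℝ)) (x : V2) : complexify f x = (f x : ℂ) := rfl

lemma dilation_apply (k : V2) : dilation k = (2 * Real.pi)⁻¹ • k := rfl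

lemma hasTemperateGrowth_coord (j : Fin 2) : (fun x : V2 ↦ x j).HasTemperateGrowth :=
  (EuclideanSpace.proj j : V2 →L[ℝ] ℝ).hasTemperateGrowth

lemma coordMul_apply (j : Fin 2) (f : 𝓢(V2, ℝ)) (x : V2) : coordMul j f x = x j * f x := by
  rw [coordMul, SchwartzMap.smulLeftCLM_apply_apply (hasTemperateGrowth_coord j), smul_eq_mul]

lemma inner_e2 (x : V2) (j : Fin 2) : (inner ℝ x (e2 j) : ℝ) = x j := by
  simp [e2, EuclideanSpace.inner_single_right]

lemma FT_eq_fourier (f : 𝓢(V2, ℝ)) (k : V2) :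
    FT f k = ((2 * Real.pi : ℝ) : ℂ)⁻¹ * 𝓕 (complexify f) (dilation k) := by
  rw [FT, SchwartzMap.fourier_coe, Real.fourier_eq']
  congr 1
  refine integral_congr_ae (.of_forall fun x ↦ ?_)
  simp only [complexify_apply, dilation_apply, inner_smul_right, smul_eq_mul, real_inner_comm x k]
  congr 2
  push_cast
  have : (Real.pi : ℂ) ≠ 0 := by exact_mod_cast Real.pi_ne_zero
  field_simp

/-- `FT f` as a Schwartz function. -/
def schwartzFT (f : 𝓢(V2, ℝ)) : 𝓢(V2, ℂ) :=
  ((2 * Real.pi : ℝ) : ℂ)⁻¹ •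
    SchwartzMap.compCLMOfContinuousLinearEquiv ℂ dilation (𝓕 (complexify f))

lemma coe_schwartzFT (f : 𝓢(V2, ℝ)) : ⇑(schwartzFT f) = FT f := by
  ext k
  rw [FT_eq_fourier]
  rfl

lemma pd_FT (f : 𝓢(V2, ℝ)) (j : Fin 2) (k : V2) :
    pd (FT f) j k = -Complex.I * FT (coordMul j f) k := by
  have hF : FT f = fun k ↦ ((2 * Real.pi : ℝ) : ℂ)⁻¹ * 𝓕 (complexify f) (dilation k) :=
    funext (FT_eq_fourier f)
  have hd : HasFDerivAt (fun k ↦ 𝓕 (complexify f) (dilation k))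
      ((fderiv ℝ ⇑(𝓕 (complexify f) : 𝓢(V2, ℂ)) (dilation k)).comp (dilation : V2 →L[ℝ] V2)) k :=
    ((𝓕 (complexify f)).differentiableAt.hasFDerivAt).comp k dilation.hasFDerivAt
  rw [pd, hF, (hd.const_mul _).fderiv, FT_eq_fourier]
  simp only [_root_.smul_apply, ContinuousLinearMap.comp_apply,
    ContinuousLinearEquiv.coe_coe, dilation_apply, map_smul]
  rw [← dilation_apply, ← SchwartzMap.lineDerivOp_apply_eq_fderiv,
    SchwartzMap.lineDerivOp_fourier_eq]
  have hmul : -(2 * Real.pi * Complex.I) •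
      SchwartzMap.smulLeftCLM ℂ (fun x : V2 ↦ (inner ℝ x (e2 j) : ℝ)) (complexify f)
      = -(2 * Real.pi * Complex.I) • complexify (coordMul j f) := by
    congr 1
    ext x
    simp only [inner_e2]
    rw [SchwartzMap.smulLeftCLM_apply_apply (hasTemperateGrowth_coord j), complexify_apply,
      complexify_apply, coordMul_apply]
    simp
  rw [hmul, FourierTransform.fourier_smul, _root_.smul_apply]
  simp only [smul_eq_mul, Complex.real_smul]
  push_cast
  have : (Real.pi : ℂ) ≠ 0 := by exact_mod_cast Real.pi_ne_zero
  field_simp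

lemma conj_FT (f : V2 → ℝ) (k : V2) :
    conj (FT f k) = ((2 * Real.pi : ℝ) : ℂ)⁻¹ *
      ∫ x : V2, Complex.exp (Complex.I * ((⟪k, x⟫ : ℝ) : ℂ)) * (f x : ℂ) := by
  rw [FT, map_mul, ← integral_conj]
  simp only [map_mul, map_inv₀, map_neg, Complex.conj_ofReal, ← Complex.exp_conj, Complex.conj_I,
    neg_neg]

lemma FT_neg (f : V2 → ℝ) (k : V2) : FT f (-k) = conj (FT f k) := by
  rw [conj_FT, FT]
  simp [inner_neg_left]

lemma FT_neg_of_comp_neg {f : V2 → ℝ} {s : ℝ} (hf : ∀ x, f (-x) = s * f x) (k : V2) :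
    FT f (-k) = s * FT f k := by
  rw [FT, FT, ← integral_neg_eq_self]
  simp only [inner_neg_left, inner_neg_right, neg_neg, hf, Complex.ofReal_mul]
  simp only [mul_left_comm _ (s : ℂ), integral_const_mul]

lemma FT_zero (f : V2 → ℝ) : FT f 0 = ((2 * Real.pi : ℝ) : ℂ)⁻¹ * ((∫ x, f x : ℝ) : ℂ) := by
  simp [FT, integral_complex_ofReal]

lemma exists_norm_FT_le (f : 𝓢(V2, ℝ)) (h0 : FT f 0 = 0) :
    ∃ C, ∀ k, ‖FT f k‖ ≤ C * ‖k‖ := by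
  have hd : ∀ k, ‖fderiv ℝ (schwartzFT f) k‖ ≤ SchwartzMap.seminorm ℝ 0 1 (schwartzFT f) := by
    intro k
    simpa [norm_iteratedFDeriv_one] using SchwartzMap.le_seminorm ℝ 0 1 (schwartzFT f) k
  refine ⟨SchwartzMap.seminorm ℝ 0 1 (schwartzFT f), fun k ↦ ?_⟩
  have := Convex.norm_image_sub_le_of_norm_fderiv_le (𝕜 := ℝ)
    (fun x _ ↦ (schwartzFT f).differentiableAt) (fun x _ ↦ hd x) convex_univ
    (Set.mem_univ 0) (Set.mem_univ k)
  simpa [coe_schwartzFT, h0] using this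

lemma Dv_lower_bound (v k : V2) : (1 - ‖v‖ ^ 2) * ‖k‖ ^ 2 ≤ Dv v k := by
  have h := abs_real_inner_le_norm v k
  have : (⟪v, k⟫ : ℝ) ^ 2 ≤ (‖v‖ * ‖k‖) ^ 2 := by
    rw [← sq_abs]
    gcongr
  rw [Dv]
  linarith [mul_pow ‖v‖ ‖k‖ 2]

@[fun_prop]
lemma measurable_Dv (v : V2) : Measurable (Dv v) := by
  unfold Dv
  fun_prop

/-- Division by the symbol `Dv v` preserves integrability when the numerator vanishes linearly
at the origin. -/
lemma integrable_div_Dv {v : V2} (hv : ‖v‖ < 1) {g : V2 → ℂ} (hg : Integrable g) {C : ℝ}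
    (hC : ∀ k, ‖g k‖ ≤ C * ‖k‖) : Integrable fun k ↦ g k / ((Dv v k : ℝ) : ℂ) := by
  have hm : AEStronglyMeasurable (fun k ↦ g k / ((Dv v k : ℝ) : ℂ)) volume := by
    have := hg.aestronglyMeasurable.aemeasurable
    exact (this.div (by fun_prop)).aestronglyMeasurable
  have hs : 0 < 1 - ‖v‖ ^ 2 := by nlinarith [norm_nonneg v]
  have hn : ∀ k, ‖g k / ((Dv v k : ℝ) : ℂ)‖ ≤ ‖g k‖ / ((1 - ‖v‖ ^ 2) * ‖k‖ ^ 2) := by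
    intro k
    have h1 := Dv_lower_bound v k
    rcases eq_or_ne k 0 with rfl | hk
    · simp [Dv]
    · have hpos : 0 < (1 - ‖v‖ ^ 2) * ‖k‖ ^ 2 := by positivity
      rw [norm_div, Complex.norm_real, Real.norm_of_nonneg (hpos.le.trans h1)]
      gcongr
  have hball : IntegrableOn (fun k ↦ g k / ((Dv v k : ℝ) : ℂ)) (Metric.ball 0 1) := by
    refine integrableOn_ball_of_norm_le_rpow (C := C / (1 - ‖v‖ ^ 2)) (α := 1) (by simp) (by simp)
      (.of_forall fun k ↦ (hn k).trans ?_) hm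
    rw [Real.rpow_neg_one]
    rcases eq_or_ne k 0 with rfl | hk
    · simp
    · have hk' : 0 < ‖k‖ := norm_pos_iff.mpr hk
      calc ‖g k‖ / ((1 - ‖v‖ ^ 2) * ‖k‖ ^ 2)
          ≤ C * ‖k‖ / ((1 - ‖v‖ ^ 2) * ‖k‖ ^ 2) := by gcongr; exact hC k
        _ = C / (1 - ‖v‖ ^ 2) * ‖k‖⁻¹ := by field_simp
  have hcompl : IntegrableOn (fun k ↦ g k / ((Dv v k : ℝ) : ℂ)) (Metric.ball 0 1)ᶜ := by
    refine ((hg.norm.div_const (1 - ‖v‖ ^ 2)).integrableOn).mono' hm.restrict ?_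
    refine (ae_restrict_mem measurableSet_ball.compl).mono fun k hk ↦ (hn k).trans ?_
    have hk1 : 1 ≤ ‖k‖ := by simpa using hk
    gcongr
    nlinarith [one_le_pow₀ hk1 (n := 2)]
  exact integrableOn_univ.mp (by simpa using hball.union hcompl)

lemma integrable_FT (f : 𝓢(V2, ℝ)) : Integrable (FT f) :=
  coe_schwartzFT f ▸ (schwartzFT f).integrable

@[fun_prop]
lemma continuous_FT (f : 𝓢(V2, ℝ)) : Continuous (FT f) :=
  coe_schwartzFT f ▸ (schwartzFT f).continuous

lemma exists_norm_FT_bound (f : 𝓢(V2, ℝ)) : ∃ C, ∀ k, ‖FT f k‖ ≤ C :=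
  ⟨_, fun k ↦ by simpa [coe_schwartzFT] using SchwartzMap.norm_le_seminorm ℝ (schwartzFT f) k⟩

lemma abs_transverse_le (v k : V2) (j : Fin 2) :
    |v j - k j * (⟪v, k⟫ : ℝ) / ‖k‖ ^ 2| ≤ 2 * ‖v‖ := by
  have hvj : |v j| ≤ ‖v‖ := by simpa using PiLp.norm_apply_le v j
  have hkj : |k j| ≤ ‖k‖ := by simpa using PiLp.norm_apply_le k j
  have hin := abs_real_inner_le_norm v k
  have h2 : |k j * (⟪v, k⟫ : ℝ) / ‖k‖ ^ 2| ≤ ‖v‖ := by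
    rw [abs_div, abs_mul, abs_of_nonneg (sq_nonneg ‖k‖)]
    refine div_le_of_le_mul₀ (by positivity) (by positivity) ?_
    calc |k j| * |(⟪v, k⟫ : ℝ)| ≤ ‖k‖ * (‖v‖ * ‖k‖) := by gcongr
      _ = ‖v‖ * ‖k‖ ^ 2 := by ring
  linarith [abs_sub (v j) (k j * (⟪v, k⟫ : ℝ) / ‖k‖ ^ 2)]

lemma Jgrad_FT (f : 𝓢(V2, ℝ)) (j : Fin 2) (k : V2) :
    Jgrad (FT f) j k =
      ![-Complex.I * FT (coordMul 1 f) k, Complex.I * FT (coordMul 0 f) k] j := by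
  fin_cases j <;> simp [Jgrad, pd_FT]

lemma integrable_Ahat (ρ : 𝓢(V2, ℝ)) (h0 : FT ρ 0 = 0) (h1 : ∀ j, FT (coordMul j ρ) 0 = 0)
    {v : V2} (hv : ‖v‖ < 1) (ω : ℝ) (j : Fin 2) : Integrable (Ahat ρ v ω j) := by
  have hFT : Integrable fun k ↦
      ((((v j - k j * (⟪v, k⟫ : ℝ) / ‖k‖ ^ 2 : ℝ) : ℂ) * FT ρ k)) / ((Dv v k : ℝ) : ℂ) := by
    obtain ⟨C, hC⟩ := exists_norm_FT_le ρ h0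
    have hb : ∀ k : V2,
        ‖((v j - k j * (⟪v, k⟫ : ℝ) / ‖k‖ ^ 2 : ℝ) : ℂ)‖ ≤ 2 * ‖v‖ := fun k ↦ by
      rw [Complex.norm_real]
      exact abs_transverse_le v k j
    refine integrable_div_Dv hv (C := 2 * ‖v‖ * C) ?_ fun k ↦ ?_
    · refine (integrable_FT ρ).bdd_mul (c := 2 * ‖v‖) ?_ (.of_forall hb)
      exact Measurable.aestronglyMeasurable (by fun_prop)
    · rw [norm_mul, mul_assoc]
      gcongr
      exacts [hb k, hC k]
  have hgrad : ∀ (l : Fin 2) (c : ℂ), Integrable fun k ↦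
      (c * FT (coordMul l ρ) k) / ((Dv v k : ℝ) : ℂ) := fun l c ↦ by
    obtain ⟨C, hC⟩ := exists_norm_FT_le (coordMul l ρ) (h1 l)
    refine integrable_div_Dv hv (C := ‖c‖ * C) ((integrable_FT _).const_mul c) fun k ↦ ?_
    rw [norm_mul, mul_assoc]
    gcongr
    exact hC k
  unfold Ahat
  simp only [sub_div, Jgrad_FT]
  refine hFT.sub ?_
  fin_cases j
  · simpa [mul_assoc] using hgrad 1 (Complex.I * ω * -Complex.I)
  · simpa [mul_assoc] using hgrad 0 (Complex.I * ω * Complex.I)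

/-- Fubini: pairing a real function with the inverse Fourier transform of `a`. -/
lemma integrable_and_integral_mul_inverse (f : 𝓢(V2, ℝ)) {a : V2 → ℂ} (ha : Integrable a) :
    let A : V2 → ℝ := fun y ↦ (((2 * Real.pi : ℝ) : ℂ)⁻¹ *
      ∫ k : V2, Complex.exp (Complex.I * ((⟪k, y⟫ : ℝ) : ℂ)) * a k).re
    Integrable (fun y ↦ f y * A y) ∧
      ∫ y, f y * A y = (∫ k, a k * conj (FT f k)).re := by
  intro A
  have hprod : Integrable (fun p : V2 × V2 ↦ ((2 * Real.pi : ℝ) : ℂ)⁻¹ *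
      (Complex.exp (Complex.I * ((⟪p.2, p.1⟫ : ℝ) : ℂ)) * ((f p.1 : ℂ) * a p.2)))
      (volume.prod volume) := by
    refine Integrable.const_mul ?_ _
    refine ((f.integrable.ofReal (𝕜 := ℂ)).mul_prod ha).bdd_mul (c := 1) ?_ (.of_forall fun p ↦ ?_)
    · exact Continuous.aestronglyMeasurable (by fun_prop)
    · rw [mul_comm, Complex.norm_exp_ofReal_mul_I]
  have hA : ∀ y, f y * A y = (∫ k, ((2 * Real.pi : ℝ) : ℂ)⁻¹ *
      (Complex.exp (Complex.I * ((⟪k, y⟫ : ℝ) : ℂ)) * ((f y : ℂ) * a k))).re := by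
    intro y
    rw [← Complex.re_ofReal_mul, mul_left_comm, ← integral_const_mul, ← integral_const_mul]
    simp only [mul_left_comm]
  simp only [hA]
  refine ⟨hprod.integral_prod_left.re, ?_⟩
  rw [show (∫ y, (∫ k, ((2 * Real.pi : ℝ) : ℂ)⁻¹ *
      (Complex.exp (Complex.I * ((⟪k, y⟫ : ℝ) : ℂ)) * ((f y : ℂ) * a k))).re) = _ from
    integral_re hprod.integral_prod_left, integral_integral_swap hprod]
  change Complex.re _ = _
  congr 2
  ext k
  rw [conj_FT, mul_left_comm, ← integral_const_mul, ← integral_const_mul]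
  congr 1
  ext y
  ring

/-- Fourier formula for the soliton angular-momentum field term:
`∫ (Jy)·A_{v,ω}(y)ρ(y)dy = -ω ∫ |∇ρ̂(k)|²/(|k|² - (v·k)²) dk`, and hence
`M_{v,ω} = ω (I + ∫ |∇ρ̂(k)|²/(|k|² - (v·k)²) dk)`. -/
theorem angular_momentum_formula
    (ρ : SchwartzMap V2 ℝ)
    (hrad : ∀ x y : V2, ‖x‖ = ‖y‖ → ρ x = ρ y)
    (hneu : (∫ x : V2, ρ x) = 0)
    (I : ℝ) (hI : 0 < I)
    (v : V2) (hv : ‖v‖ < 1) (ω : ℝ) :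
    angTerm (⇑ρ) (Asol (⇑ρ) v ω)
        = -ω * ∫ k : V2, gradNormSqC (FT (⇑ρ)) k / Dv v k
    ∧ Msol (⇑ρ) I v ω = ω * (I + ∫ k : V2, gradNormSqC (FT (⇑ρ)) k / Dv v k) := by
  have hneg : ∀ x, ρ (-x) = 1 * ρ x := fun x ↦ by rw [one_mul, hrad (-x) x (norm_neg x)]
  have hnegc : ∀ j x, coordMul j ρ (-x) = (-1 : ℝ) * coordMul j ρ x := fun j x ↦ by
    simp [coordMul_apply, hneg]
  have h0 : FT ρ 0 = 0 := by simp [FT_zero, hneu]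
  have h1 : ∀ j, FT (coordMul j ρ) 0 = 0 := fun j ↦ by
    have := FT_neg_of_comp_neg (hnegc j) 0
    rw [neg_zero] at this
    push_cast at this
    linear_combination this / 2
  have hreal : ∀ k, conj (FT ρ k) = FT ρ k := fun k ↦ by
    rw [← FT_neg, FT_neg_of_comp_neg hneg]
    simp
  have himag : ∀ j k, conj (FT (coordMul j ρ) k) = -FT (coordMul j ρ) k := fun j k ↦ by
    rw [← FT_neg, FT_neg_of_comp_neg (hnegc j)]
    simp
  have hmain : angTerm ρ (Asol ρ v ω) = -ω * ∫ k : V2, gradNormSqC (FT ρ) k / Dv v k := by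
    have hA := integrable_Ahat ρ h0 h1 hv ω
    obtain ⟨hi0, he0⟩ := integrable_and_integral_mul_inverse (coordMul 1 ρ) (hA 0)
    obtain ⟨hi1, he1⟩ := integrable_and_integral_mul_inverse (coordMul 0 ρ) (hA 1)
    have hprod : ∀ i j, Integrable fun k ↦ Ahat ρ v ω i k * conj (FT (coordMul j ρ) k) :=
      fun i j ↦ by
        obtain ⟨C, hC⟩ := exists_norm_FT_bound (coordMul j ρ)
        refine (hA i).mul_bdd (c := C) ?_ (.of_forall fun k ↦ by simpa using hC k)
        exact Continuous.aestronglyMeasurable (by fun_prop)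
    calc angTerm ρ (Asol ρ v ω)
        = ∫ y, (coordMul 1 ρ y * Asol ρ v ω 0 y - coordMul 0 ρ y * Asol ρ v ω 1 y) := by
          refine integral_congr_ae (.of_forall fun y ↦ ?_)
          simp only [coordMul_apply]
          ring
      _ = (∫ k, (Ahat ρ v ω 0 k * conj (FT (coordMul 1 ρ) k)
            - Ahat ρ v ω 1 k * conj (FT (coordMul 0 ρ) k))).re := by
          rw [integral_sub (hprod 0 1) (hprod 1 0), Complex.sub_re, ← he0, ← he1]
          exact integral_sub hi0 hi1
      _ = ∫ k, (Ahat ρ v ω 0 k * conj (FT (coordMul 1 ρ) k)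
            - Ahat ρ v ω 1 k * conj (FT (coordMul 0 ρ) k)).re :=
          (integral_re ((hprod 0 1).sub (hprod 1 0))).symm
      _ = ∫ k, -ω * (gradNormSqC (FT ρ) k / Dv v k) := by
          refine integral_congr_ae (.of_forall fun k ↦ ?_)
          have hr := Complex.conj_eq_iff_im.mp (hreal k)
          have hre : ∀ j, (FT (coordMul j ρ) k).re = 0 := fun j ↦ by
            have := congrArg Complex.re (himag j k)
            simp only [Complex.conj_re, Complex.neg_re] at this
            linarith
          simp only [Ahat]
          generalize (v 0 - k 0 * (⟪v, k⟫ : ℝ) / ‖k‖ ^ 2 : ℝ) = a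
          generalize (v 1 - k 1 * (⟪v, k⟫ : ℝ) / ‖k‖ ^ 2 : ℝ) = b
          simp [Jgrad_FT, gradNormSqC, pd_FT, Complex.div_ofReal_re, Complex.div_ofReal_im,
            hr, hre, Complex.sq_norm, Complex.normSq_apply]
          ring
      _ = _ := integral_const_mul _ _
  refine ⟨hmain, ?_⟩
  rw [Msol, hmain]
  ring

end
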